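/- The function F(n_1,…,n_r) = lim_{m→∞} dim_𝕜( R / J(1)_{m n_1}⋯J(r)_{m n_r} ) / m^d is well defined (the limit exists) for all 𝐧 = (n_1,…,n_r) ∈ ℕ^r and is equal to a homogeneous polynomial G(n_1,…,n_r) of total degree d with real coefficients. -/

import Mathlib

open Filter MvPolynomial Pointwise MeasureTheory

noncomputable section

/-- The graded irrelevant (maximal graded) ideal `𝔪 = (x_1, …, x_d)` of `𝕜[x_1, …, x_d]`. -/
def mId (𝕜 : Type*) [Field 𝕜] (d : ℕ) : Ideal (MvPolynomial (Fin d) 𝕜) :=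
  Ideal.span (Set.range MvPolynomial.X)

/-- A graded family of ideals: `I 0 = R` and `I i * I j ⊆ I (i + j)`. -/
def IsGradedFamily {R : Type*} [CommSemiring R] (I : ℕ → Ideal R) : Prop :=
  I 0 = ⊤ ∧ ∀ i j : ℕ, I i * I j ≤ I (i + j)

/-- An `𝔪`-primary ideal of the polynomial ring: a proper ideal containing a power of `𝔪`. -/
def IsMPrimary {𝕜 : Type*} [Field 𝕜] {d : ℕ} (I : Ideal (MvPolynomial (Fin d) 𝕜)) : Prop :=
  I ≠ ⊤ ∧ ∃ k : ℕ, mId 𝕜 d ^ k ≤ I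

/-- A monomial ideal: an ideal generated by monomials. -/
def IsMonomialIdeal {𝕜 : Type*} [Field 𝕜] {d : ℕ} (I : Ideal (MvPolynomial (Fin d) 𝕜)) : Prop :=
  ∃ S : Set (Fin d →₀ ℕ), I = Ideal.span ((fun m => MvPolynomial.monomial m (1 : 𝕜)) '' S)

/-- A nonzero monomial ideal generated by monomials of degree at most `b`;
for nonzero monomial ideals this is exactly the condition `β(I) ≤ b`. -/
def IsMonomialBounded {𝕜 : Type*} [Field 𝕜] {d : ℕ} (I : Ideal (MvPolynomial (Fin d) 𝕜))
    (b : ℕ) : Prop :=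
  I ≠ ⊥ ∧ ∃ S : Set (Fin d →₀ ℕ), (∀ m ∈ S, (∑ j, m j) ≤ b) ∧
    I = Ideal.span ((fun m => MvPolynomial.monomial m (1 : 𝕜)) '' S)

/-- The `𝕜`-vector space dimension of the quotient `A / (A ⊓ B)`; for `B ⊆ A`
this is `dim_𝕜 (A / B)`. -/
def quotDim (𝕜 : Type*) [Field 𝕜] {R : Type*} [CommRing R] [Algebra 𝕜 R]
    (A B : Ideal R) : ℕ :=
  Module.finrank 𝕜
    (↥(Submodule.restrictScalars 𝕜 A) ⧸
      Submodule.comap (Submodule.restrictScalars 𝕜 A).subtype (Submodule.restrictScalars 𝕜 B))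

section MonomialIdeals

variable {𝕜 : Type*} [Field 𝕜] {d : ℕ} {I K : Ideal (MvPolynomial (Fin d) 𝕜)}

theorem IsMonomialIdeal.top : IsMonomialIdeal (⊤ : Ideal (MvPolynomial (Fin d) 𝕜)) := by
  refine ⟨{0}, ?_⟩
  rw [Set.image_singleton, eq_comm, Ideal.eq_top_iff_one]
  exact Ideal.subset_span rfl

theorem IsMonomialIdeal.mul (hI : IsMonomialIdeal I) (hK : IsMonomialIdeal K) :
    IsMonomialIdeal (I * K) := by
  obtain ⟨S, rfl⟩ := hI
  obtain ⟨T, rfl⟩ := hK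
  refine ⟨S + T, ?_⟩
  rw [Ideal.span_mul_span']
  congr 1
  ext p
  simp only [Set.mem_mul, Set.mem_image, Set.mem_add]
  constructor
  · rintro ⟨_, ⟨s, hs, rfl⟩, _, ⟨t, ht, rfl⟩, rfl⟩
    exact ⟨s + t, ⟨s, hs, t, ht, rfl⟩, by simp [MvPolynomial.monomial_mul]⟩
  · rintro ⟨_, ⟨s, hs, t, ht, rfl⟩, rfl⟩
    exact ⟨_, ⟨s, hs, rfl⟩, _, ⟨t, ht, rfl⟩, by simp [MvPolynomial.monomial_mul]⟩

theorem IsMonomialIdeal.pow (hI : IsMonomialIdeal I) (n : ℕ) : IsMonomialIdeal (I ^ n) := by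
  induction n with
  | zero => simpa using IsMonomialIdeal.top
  | succ n ih => exact pow_succ I n ▸ ih.mul hI

theorem IsMonomialIdeal.prod {ι : Type*} {s : Finset ι}
    {I : ι → Ideal (MvPolynomial (Fin d) 𝕜)} (hI : ∀ i, IsMonomialIdeal (I i)) :
    IsMonomialIdeal (∏ i ∈ s, I i) :=
  Finset.prod_induction _ IsMonomialIdeal (fun _ _ h h' => h.mul h')
    (Ideal.one_eq_top (R := MvPolynomial (Fin d) 𝕜) ▸ IsMonomialIdeal.top) fun i _ => hI i

/-- Membership in a monomial ideal is tested on monomials. -/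
theorem IsMonomialIdeal.mem_iff (hI : IsMonomialIdeal I) {p : MvPolynomial (Fin d) 𝕜} :
    p ∈ I ↔ ∀ x ∈ p.support, monomial x (1 : 𝕜) ∈ I := by
  obtain ⟨S, rfl⟩ := hI
  simp only [mem_ideal_span_monomial_image]
  refine forall₂_congr fun x _ => ?_
  simp

theorem monomial_mem_of_le {x y : Fin d →₀ ℕ} (h : x ≤ y) (hx : monomial x (1 : 𝕜) ∈ I) :
    monomial y (1 : 𝕜) ∈ I := by
  obtain ⟨z, rfl⟩ := exists_add_of_le h
  have := I.mul_mem_right (monomial z 1) hx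
  simpa [MvPolynomial.monomial_mul] using this

theorem monomial_add_mem_mul {x y : Fin d →₀ ℕ} (hx : monomial x (1 : 𝕜) ∈ I)
    (hy : monomial y (1 : 𝕜) ∈ K) : monomial (x + y) (1 : 𝕜) ∈ I * K := by
  have := Ideal.mul_mem_mul hx hy
  simpa [MvPolynomial.monomial_mul] using this

theorem monomial_nsmul_mem_pow {x : Fin d →₀ ℕ} (hx : monomial x (1 : 𝕜) ∈ I) (n : ℕ) :
    monomial (n • x) (1 : 𝕜) ∈ I ^ n := by
  have := Ideal.pow_mem_pow hx n
  simpa [MvPolynomial.monomial_pow] using this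

theorem IsMonomialIdeal.exists_add_of_mem_mul (hI : IsMonomialIdeal I) (hK : IsMonomialIdeal K)
    {x : Fin d →₀ ℕ} (hx : monomial x (1 : 𝕜) ∈ I * K) :
    ∃ y z, monomial y (1 : 𝕜) ∈ I ∧ monomial z (1 : 𝕜) ∈ K ∧ y + z = x := by
  obtain ⟨S, rfl⟩ := hI
  obtain ⟨T, rfl⟩ := hK
  have h : Ideal.span ((fun m => MvPolynomial.monomial m (1 : 𝕜)) '' S) *
      Ideal.span ((fun m => MvPolynomial.monomial m (1 : 𝕜)) '' T) ≤
      Ideal.span ((fun m => MvPolynomial.monomial m (1 : 𝕜)) '' (S + T)) := by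
    rw [Ideal.span_mul_span', Ideal.span_le]
    rintro _ ⟨_, ⟨s, hs, rfl⟩, _, ⟨t, ht, rfl⟩, rfl⟩
    exact Ideal.subset_span ⟨s + t, ⟨s, hs, t, ht, rfl⟩, by simp [MvPolynomial.monomial_mul]⟩
  obtain ⟨_, ⟨s, hs, t, ht, rfl⟩, hle⟩ := mem_ideal_span_monomial_image.1 (h hx) x
    (by simp)
  obtain ⟨z, rfl⟩ := exists_add_of_le hle
  exact ⟨s, t + z, Ideal.subset_span ⟨s, hs, rfl⟩,
    monomial_mem_of_le le_self_add (Ideal.subset_span ⟨t, ht, rfl⟩), (add_assoc _ _ _).symm⟩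

theorem monomial_mem_of_mId_pow_le {c : ℕ} (hc : mId 𝕜 d ^ c ≤ I) {x : Fin d →₀ ℕ}
    (hx : c ≤ x.degree) : monomial x (1 : 𝕜) ∈ I :=
  hc ((monomial_mem_pow_idealOfVars_iff c x one_ne_zero).2 hx)

/-- The number of monomials outside an ideal of a polynomial ring. -/
def colength (I : Ideal (MvPolynomial (Fin d) 𝕜)) : ℕ :=
  {x : Fin d →₀ ℕ | monomial x (1 : 𝕜) ∉ I}.ncard

theorem finite_monomial_notMem {c : ℕ} (hc : mId 𝕜 d ^ c ≤ I) :
    {x : Fin d →₀ ℕ | monomial x (1 : 𝕜) ∉ I}.Finite :=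
  (Finsupp.finite_of_degree_lt c).subset fun _ hx =>
    not_le.1 fun h => hx (monomial_mem_of_mId_pow_le hc h)

theorem finrank_quotient_eq_colength (hI : IsMonomialIdeal I) {c : ℕ} (hc : mId 𝕜 d ^ c ≤ I) :
    Module.finrank 𝕜 (MvPolynomial (Fin d) 𝕜 ⧸ I) = colength I := by
  classical
  have : Fintype {x : Fin d →₀ ℕ | monomial x (1 : 𝕜) ∉ I} := (finite_monomial_notMem hc).fintype
  let f : MvPolynomial (Fin d) 𝕜 →ₗ[𝕜] ({x : Fin d →₀ ℕ | monomial x (1 : 𝕜) ∉ I} → 𝕜) :=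
    LinearMap.pi fun x => lcoeff 𝕜 (x : Fin d →₀ ℕ)
  have hker : LinearMap.ker f = I.restrictScalars 𝕜 := by
    ext p
    rw [LinearMap.mem_ker, Submodule.restrictScalars_mem, hI.mem_iff, funext_iff]
    simp only [Subtype.forall, Set.mem_ofPred_eq, mem_support_iff, f, LinearMap.pi_apply,
      lcoeff_apply, Pi.zero_apply]
    exact forall_congr' fun x => by tauto
  have hsurj : Function.Surjective f := by
    intro g
    refine ⟨∑ x : {x : Fin d →₀ ℕ | monomial x (1 : 𝕜) ∉ I}, monomial (x : Fin d →₀ ℕ) (g x), ?_⟩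
    ext y
    simp [f, coeff_monomial, Subtype.coe_inj]
  have e := (Submodule.quotEquivOfEq _ _ hker).symm.trans (f.quotKerEquivOfSurjective hsurj)
  have e' : (MvPolynomial (Fin d) 𝕜 ⧸ I) ≃ₗ[𝕜]
    (MvPolynomial (Fin d) 𝕜 ⧸ I.restrictScalars 𝕜) := Submodule.Quotient.restrictScalarsEquiv 𝕜 I |>.symm
  rw [(e'.trans e).finrank_eq, Module.finrank_fintype_fun_eq_card, colength,
    ← Nat.card_coe_set_eq, Nat.card_eq_fintype_card]

theorem colength_anti (h : I ≤ K) {c : ℕ} (hc : mId 𝕜 d ^ c ≤ I) : colength K ≤ colength I :=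
  Set.ncard_le_ncard (fun _ hx hx' => hx (h hx')) (finite_monomial_notMem hc)

theorem colength_pow_le {c : ℕ} (hc : mId 𝕜 d ^ c ≤ I) (k : ℕ) :
    colength (I ^ k) ≤ k ^ d * colength I := by
  classical
  rcases Nat.eq_zero_or_pos k with rfl | hk
  · simp [colength]
  have hfin := finite_monomial_notMem hc
  have hcard : colength I = hfin.toFinset.card := Set.ncard_eq_toFinset_card _ hfin
  have key : {x : Fin d →₀ ℕ | monomial x (1 : 𝕜) ∉ I ^ k}.ncard ≤
      (Fintype.piFinset (fun _ : Fin d => Finset.range k) ×ˢ hfin.toFinset :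
        Finset ((Fin d → ℕ) × (Fin d →₀ ℕ))).card := by
    rw [← Set.ncard_coe_finset]
    refine Set.ncard_le_ncard_of_injOn
      (fun x => (fun j => x j % k, Finsupp.equivFunOnFinite.symm fun j => x j / k)) ?_ ?_
      (Finset.finite_toSet _)
    · intro x hx
      simp only [Finset.coe_product, Set.mem_prod, Finset.mem_coe, Fintype.mem_piFinset,
        Finset.mem_range, Set.Finite.mem_toFinset, Set.mem_ofPred_eq]
      refine ⟨fun j => Nat.mod_lt _ hk, fun h => hx ?_⟩
      refine monomial_mem_of_le (fun j => ?_) (monomial_nsmul_mem_pow h k)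
      simpa using Nat.mul_div_le (x j) k
    · intro x _ y _ hxy
      simp only [Prod.mk.injEq, EmbeddingLike.apply_eq_iff_eq] at hxy
      ext j
      rw [← Nat.div_add_mod (x j) k, ← Nat.div_add_mod (y j) k, congrFun hxy.1 j, congrFun hxy.2 j]
  simpa [colength, Fintype.card_piFinset, hcard, ← Set.ncard_eq_toFinset_card _ hfin] using key

/-- Multiplying by an ideal that contains `𝔪 ^ c` costs only a boundary term. -/
theorem colength_mul_le (hd : 0 < d) {p c : ℕ} (hc0 : 0 < c) (hp : mId 𝕜 d ^ p ≤ I)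
    (hc : mId 𝕜 d ^ c ≤ K) :
    colength (I * K) ≤ colength I + c * (p + c) ^ (d - 1) := by
  classical
  have hpc : mId 𝕜 d ^ (p + c) ≤ I * K := pow_add (mId 𝕜 d) p c ▸ Ideal.mul_mono hp hc
  obtain ⟨e, rfl⟩ : ∃ e, d = e + 1 := ⟨d - 1, by omega⟩
  set B : Set (Fin (e + 1) →₀ ℕ) :=
    {x | monomial x (1 : 𝕜) ∉ I * K ∧ monomial x (1 : 𝕜) ∈ I} with hB
  have hsub : {x : Fin (e + 1) →₀ ℕ | monomial x (1 : 𝕜) ∉ I * K} ⊆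
      {x | monomial x (1 : 𝕜) ∉ I} ∪ B := by
    intro x hx
    by_cases h : monomial x (1 : 𝕜) ∈ I
    · exact Or.inr ⟨hx, h⟩
    · exact Or.inl h
  have hBfin : B.Finite := (finite_monomial_notMem hpc).subset fun x hx => hx.1
  have hBcard : B.ncard ≤ (Finset.range c ×ˢ
      Fintype.piFinset (fun _ : Fin e => Finset.range (p + c)) : Finset (ℕ × (Fin e → ℕ))).card := by
    rw [← Set.ncard_coe_finset]
    refine Set.ncard_le_ncard_of_injOn (fun x => (x 0 % c, fun j => x j.succ)) ?_ ?_
      (Finset.finite_toSet _)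
    · intro x hx
      simp only [Finset.coe_product, Set.mem_prod, Finset.mem_coe, Fintype.mem_piFinset,
        Finset.mem_range]
      refine ⟨Nat.mod_lt _ hc0, fun j => ?_⟩
      have h1 : x.degree < p + c :=
        not_le.1 fun h => hx.1 (monomial_mem_of_mId_pow_le hpc h)
      exact (Finsupp.le_degree j.succ x).trans_lt h1
    · have aux : ∀ x ∈ B, ∀ y ∈ B, x 0 % c = y 0 % c → (∀ j : Fin e, x j.succ = y j.succ) →
          ¬ x 0 < y 0 := by
        intro x hx y hy h0 hj hlt
        have hmod : c ∣ y 0 - x 0 := (Nat.modEq_iff_dvd' hlt.le).1 h0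
        have hge : c ≤ y 0 - x 0 := Nat.le_of_dvd (by omega) hmod
        refine hy.1 (monomial_mem_of_le (x := x + Finsupp.single 0 c) ?_
          (monomial_add_mem_mul hx.2 (monomial_mem_of_mId_pow_le hc (by simp))))
        intro j
        refine Fin.cases ?_ (fun j => ?_) j
        · simp; omega
        · simp [hj]
      intro x hx y hy hxy
      simp only [Prod.mk.injEq] at hxy
      have h1 := aux x hx y hy hxy.1 (congrFun hxy.2)
      have h2 := aux y hy x hx hxy.1.symm fun j => (congrFun hxy.2 j).symm
      ext j
      refine Fin.cases ?_ (fun j => ?_) j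
      · omega
      · exact congrFun hxy.2 j
  calc colength (I * K) ≤ ({x | monomial x (1 : 𝕜) ∉ I} ∪ B).ncard :=
        Set.ncard_le_ncard hsub ((finite_monomial_notMem hp).union hBfin)
    _ ≤ colength I + B.ncard := Set.ncard_union_le _ _
    _ ≤ _ := by
      gcongr
      simpa using hBcard

theorem exists_colength_pow_mul_le (hd : 0 < d) {p c : ℕ} (hp : mId 𝕜 d ^ p ≤ I)
    (hc : mId 𝕜 d ^ c ≤ K) :
    ∃ C : ℕ, ∀ k m : ℕ, k ≤ m → 0 < m →
      colength (I ^ k * K) ≤ colength (I ^ k) + C * m ^ (d - 1) := by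
  refine ⟨(c + 1) * (p + (c + 1)) ^ (d - 1), fun k m hkm hm => ?_⟩
  have hK : mId 𝕜 d ^ (c + 1) ≤ K := (Ideal.pow_le_pow_right c.le_succ).trans hc
  have hI : mId 𝕜 d ^ (p * k) ≤ I ^ k := pow_mul (mId 𝕜 d) p k ▸ Ideal.pow_right_mono hp k
  refine (colength_mul_le hd c.succ_pos hI hK).trans ?_
  rw [mul_assoc, ← mul_pow]
  gcongr
  nlinarith [Nat.mul_le_mul_left p hkm]

end MonomialIdeals

section Limit

theorem tendsto_iInf_of_le_add_div {u : ℕ → ℝ} (h0 : ∀ m, 0 ≤ u m)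
    (h : ∀ a, 0 < a → ∃ K : ℝ, ∀ m : ℕ, 0 < m → u m ≤ u a + K / m) :
    ∃ L : ℝ, Tendsto u atTop (nhds L) ∧ ∀ a, 0 < a → L ≤ u a := by
  have hbdd : BddBelow (Set.range fun a : ℕ => u (a + 1)) := ⟨0, by rintro _ ⟨a, rfl⟩; exact h0 _⟩
  have hle : ∀ a, 0 < a → ⨅ a : ℕ, u (a + 1) ≤ u a := by
    intro a ha
    obtain ⟨b, rfl⟩ : ∃ b, a = b + 1 := ⟨a - 1, by omega⟩
    exact ciInf_le hbdd b
  refine ⟨⨅ a : ℕ, u (a + 1), ?_, hle⟩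
  refine tendsto_order.2 ⟨fun b hb => ?_, fun b hb => ?_⟩
  · filter_upwards [eventually_gt_atTop 0] with m hm using hb.trans_le (hle m hm)
  · obtain ⟨a, ha⟩ := exists_lt_of_ciInf_lt hb
    obtain ⟨K, hK⟩ := h (a + 1) a.succ_pos
    have hlim : Tendsto (fun m : ℕ => u (a + 1) + K / m) atTop (nhds (u (a + 1) + 0)) :=
      tendsto_const_nhds.add (tendsto_const_div_atTop_nhds_zero_nat K)
    rw [add_zero] at hlim
    filter_upwards [hlim.eventually_lt_const ha, eventually_gt_atTop 0] with m hm hm0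
    exact (hK m hm0).trans_lt hm

variable {𝕜 : Type*} [Field 𝕜] {d : ℕ}

theorem IsGradedFamily.pow_le {R : Type*} [CommSemiring R] {I : ℕ → Ideal R}
    (hI : IsGradedFamily I) (a q : ℕ) : I a ^ q ≤ I (a * q) := by
  induction q with
  | zero => simp [hI.1]
  | succ q ih =>
    rw [pow_succ, Nat.mul_succ]
    exact (Ideal.mul_mono_left ih).trans (hI.2 _ _)

theorem IsGradedFamily.prod {R ι : Type*} [CommSemiring R] {s : Finset ι}
    {I : ι → ℕ → Ideal R} (hI : ∀ i, IsGradedFamily (I i)) (n : ι → ℕ) :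
    IsGradedFamily fun m => ∏ i ∈ s, I i (m * n i) := by
  refine ⟨?_, fun i j => ?_⟩
  · simp only [zero_mul, (hI _).1, ← Ideal.one_eq_top, Finset.prod_const_one]
  · rw [← Finset.prod_mul_distrib]
    refine Finset.prod_le_prod' fun k _ => ?_
    rw [add_mul]
    exact (hI k).2 _ _

theorem isGradedFamily_pow {R : Type*} [CommSemiring R] (I : Ideal R) :
    IsGradedFamily fun m => I ^ m :=
  ⟨by simp, fun i j => (pow_add I i j).ge⟩

theorem exists_tendsto_colength (hd : 0 < d) {P : ℕ → Ideal (MvPolynomial (Fin d) 𝕜)}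
    (hP : IsGradedFamily P) (hc : ∀ n, ∃ c, mId 𝕜 d ^ c ≤ P n) :
    ∃ L : ℝ, Tendsto (fun m : ℕ => (colength (P m) : ℝ) / (m : ℝ) ^ d) atTop (nhds L) ∧
      ∀ a : ℕ, 0 < a → L ≤ (colength (P a) : ℝ) / (a : ℝ) ^ d := by
  refine tendsto_iInf_of_le_add_div (fun m => by positivity) fun a ha => ?_
  choose c hc using hc
  choose C hC using fun s => exists_colength_pow_mul_le hd (hc a) (hc s)
  refine ⟨∑ s ∈ Finset.range a, (C s : ℝ), fun m hm => ?_⟩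
  set q := m / a
  set s := m % a
  have hqs : a * q + s = m := Nat.div_add_mod m a
  have hs : s < a := Nat.mod_lt _ ha
  have hle : P a ^ q * P s ≤ P m := by
    have := (Ideal.mul_mono_left (hP.pow_le a q)).trans (hP.2 (a * q) s)
    rwa [hqs] at this
  have hcof : mId 𝕜 d ^ (c a * q + c s) ≤ P a ^ q * P s := by
    rw [pow_add, pow_mul]
    exact Ideal.mul_mono (Ideal.pow_right_mono (hc a) q) (hc s)
  have h1 : colength (P m) ≤ q ^ d * colength (P a) + C s * m ^ (d - 1) :=
    (colength_anti hle hcof).trans <| (hC s q m (Nat.div_le_self _ _) hm).trans <|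
      Nat.add_le_add_right (colength_pow_le (hc a) q) _
  have h2 : (colength (P m) : ℝ) ≤ (q : ℝ) ^ d * colength (P a) + C s * (m : ℝ) ^ (d - 1) := by
    exact_mod_cast h1
  have hm' : (0 : ℝ) < m := by exact_mod_cast hm
  have ha' : (0 : ℝ) < a := by exact_mod_cast ha
  have hqm : (q : ℝ) ≤ m / a := Nat.cast_div_le
  have hCs : (C s : ℝ) ≤ ∑ s ∈ Finset.range a, (C s : ℝ) :=
    Finset.single_le_sum (f := fun s => (C s : ℝ)) (fun _ _ => by positivity)
      (Finset.mem_range.2 hs)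
  have hmd : (m : ℝ) ^ d = m ^ (d - 1) * m := by rw [← pow_succ, Nat.sub_add_cancel hd]
  calc (colength (P m) : ℝ) / (m : ℝ) ^ d
      ≤ ((m / a : ℝ) ^ d * colength (P a) +
        (∑ s ∈ Finset.range a, (C s : ℝ)) * (m : ℝ) ^ (d - 1)) / (m : ℝ) ^ d := by
        gcongr
        exact h2.trans (by gcongr)
    _ = _ := by
        rw [add_div, div_pow]
        congr 1
        · field_simp
        · rw [hmd]; field_simp

end Limit

section EventuallyPolynomial

variable {r k : ℕ}

theorem eval_bind₁_eq {R σ τ : Type*} [CommSemiring R] (x : τ → R) (g : σ → MvPolynomial τ R)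
    (P : MvPolynomial σ R) : eval x (bind₁ g P) = eval (fun i => eval x (g i)) P :=
  eval₂Hom_bind₁ _ _ _ _

/-- A function on `ℕ^r` that agrees with a polynomial wherever all coordinates are large. -/
def IsEventuallyPolynomial (f : (Fin r → ℕ) → ℝ) : Prop :=
  ∃ (P : MvPolynomial (Fin r) ℝ) (N : ℕ), ∀ n : Fin r → ℕ, (∀ i, N ≤ n i) →
    f n = eval (fun i => (n i : ℝ)) P

theorem IsEventuallyPolynomial.add {f g : (Fin r → ℕ) → ℝ} (hf : IsEventuallyPolynomial f)
    (hg : IsEventuallyPolynomial g) : IsEventuallyPolynomial fun n => f n + g n := by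
  obtain ⟨P, N, hP⟩ := hf
  obtain ⟨Q, M, hQ⟩ := hg
  refine ⟨P + Q, max N M, fun n hn => ?_⟩
  simp only [hP n fun i => (le_max_left _ _).trans (hn i),
    hQ n fun i => (le_max_right _ _).trans (hn i), map_add]

theorem IsEventuallyPolynomial.sub {f g : (Fin r → ℕ) → ℝ} (hf : IsEventuallyPolynomial f)
    (hg : IsEventuallyPolynomial g) : IsEventuallyPolynomial fun n => f n - g n := by
  obtain ⟨P, N, hP⟩ := hf
  obtain ⟨Q, M, hQ⟩ := hg
  refine ⟨P - Q, max N M, fun n hn => ?_⟩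
  simp only [hP n fun i => (le_max_left _ _).trans (hn i),
    hQ n fun i => (le_max_right _ _).trans (hn i), map_sub]

theorem IsEventuallyPolynomial.of_shift {f g : (Fin r → ℕ) → ℝ} (hg : IsEventuallyPolynomial g)
    (s : Fin r → ℕ) (h : ∀ n, f (n + s) = g n) : IsEventuallyPolynomial f := by
  obtain ⟨P, N, hP⟩ := hg
  refine ⟨bind₁ (fun i => X i - C (s i : ℝ)) P, N + ∑ i, s i, fun n hn => ?_⟩
  have hs : ∀ i, s i ≤ ∑ i, s i := fun i =>
    Finset.single_le_sum (f := s) (fun _ _ => Nat.zero_le _) (Finset.mem_univ i)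
  have hsn : s ≤ n := fun i => (hs i).trans (le_add_self.trans (hn i))
  have hf : f n = g (n - s) := by rw [← h, tsub_add_cancel_of_le hsn]
  have hN : ∀ i, N ≤ (n - s) i := fun i =>
    Nat.le_sub_of_add_le ((Nat.add_le_add_left (hs i) N).trans (hn i))
  rw [hf, hP _ hN, eval_bind₁_eq]
  congr 2
  ext i
  simp [Nat.cast_sub (hsn i)]

/-- The exponent vectors of the products of `n i` factors of each colour `i`, where every colour
has `k` letters. -/
def colouredVectors (k : ℕ) (n : Fin r → ℕ) : Finset (Fin r → Fin k →₀ ℕ) :=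
  Fintype.piFinset fun i => Finset.finsuppAntidiag Finset.univ (n i)

theorem mem_colouredVectors {n : Fin r → ℕ} {v : Fin r → Fin k →₀ ℕ} :
    v ∈ colouredVectors k n ↔ ∀ i, (v i).degree = n i := by
  simp [colouredVectors, Finset.mem_finsuppAntidiag, Finsupp.degree_eq_sum]

theorem isEventuallyPolynomial_card_colouredVectors (hk : 0 < k) :
    IsEventuallyPolynomial fun n : Fin r → ℕ => ((colouredVectors k n).card : ℝ) := by
  refine ⟨∏ i, Polynomial.aeval (X i) (Polynomial.preHilbertPoly ℝ (k - 1) 0), 0, fun n _ => ?_⟩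
  simp only [colouredVectors, Fintype.card_piFinset, Nat.cast_prod, map_prod]
  refine Finset.prod_congr rfl fun i _ => ?_
  have h : eval (fun i => (n i : ℝ))
      (Polynomial.aeval (X i) (Polynomial.preHilbertPoly ℝ (k - 1) 0)) =
      Polynomial.eval (n i : ℝ) (Polynomial.preHilbertPoly ℝ (k - 1) 0) := by
    rw [← coe_aeval_eq_eval, RingHom.coe_coe, ← Polynomial.aeval_algHom_apply]
    simp
  rw [h, Polynomial.preHilbertPoly_eq_choose_sub_add _ _ (Nat.zero_le _),
    Finset.card_finsuppAntidiag_nat_eq_choose, Finset.card_univ, Fintype.card_fin]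
  have e : k + n i - 1 = n i + (k - 1) := by omega
  rw [e, Nat.choose_symm_add, Nat.sub_zero]

open Classical in
theorem isEventuallyPolynomial_card_filter_le (hk : 0 < k) (u : Fin r → Fin k →₀ ℕ) :
    IsEventuallyPolynomial fun n : Fin r → ℕ =>
      (((colouredVectors k n).filter fun v => u ≤ v).card : ℝ) := by
  refine (isEventuallyPolynomial_card_colouredVectors hk).of_shift (fun i => (u i).degree)
    fun n => ?_
  norm_cast
  symm
  refine Finset.card_bij' (fun v _ => v + u) (fun v _ => v - u) ?_ ?_ ?_ ?_
  · intro v hv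
    simp only [Finset.mem_filter, mem_colouredVectors, Pi.add_apply, map_add] at hv ⊢
    exact ⟨fun i => by rw [hv], le_add_self⟩
  · intro v hv
    simp only [Finset.mem_filter, mem_colouredVectors, Pi.add_apply] at hv ⊢
    obtain ⟨hv, hle⟩ := hv
    intro i
    have := hv i
    rw [← tsub_add_cancel_of_le hle] at this
    simpa using this
  · intro v _
    simp
  · intro v hv
    exact tsub_add_cancel_of_le (Finset.mem_filter.1 hv).2

open Classical in
theorem isEventuallyPolynomial_card_filter_exists_mem_list (hk : 0 < k) (l : ℕ) :
    ∀ L : List (Fin r → Fin k →₀ ℕ), L.length = l →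
      IsEventuallyPolynomial fun n : Fin r → ℕ =>
        (((colouredVectors k n).filter fun v => ∃ u ∈ L, u ≤ v).card : ℝ) := by
  induction l with
  | zero =>
    intro L hL
    rw [List.length_eq_zero_iff] at hL
    exact ⟨0, 0, fun n _ => by simp [hL]⟩
  | succ l ih =>
    rintro (_ | ⟨u, L⟩) hL
    · simp at hL
    have hL' : L.length = l := by simpa using hL
    have h := ((isEventuallyPolynomial_card_filter_le hk u).add (ih L hL')).sub
      (ih (L.map fun w => u ⊔ w) (by simpa using hL'))
    convert h using 2 with n
    rw [eq_sub_iff_add_eq]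
    norm_cast
    rw [← Finset.card_union_add_card_inter (Finset.filter (fun v => u ≤ v) _), ← Finset.filter_or,
      ← Finset.filter_and]
    congr 3
    · ext v
      simp
    · ext v
      simp only [List.mem_map]
      aesop

open Classical in
theorem isEventuallyPolynomial_card_filter_mem (hk : 0 < k) {U : Set (Fin r → Fin k →₀ ℕ)}
    (hU : IsUpperSet U) :
    IsEventuallyPolynomial fun n : Fin r → ℕ =>
      (((colouredVectors k n).filter fun v => v ∈ U).card : ℝ) := by
  have hfin : {v | Minimal (· ∈ U) v}.Finite :=
    WellQuasiOrderedLE.finite_of_isAntichain (setOfPred_minimal_antichain _)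
  convert isEventuallyPolynomial_card_filter_exists_mem_list hk _ hfin.toFinset.toList rfl
    using 6 with n v
  constructor
  · intro hv
    obtain ⟨u, huv, hu⟩ := (Set.isPWO_of_wellQuasiOrderedLE U).exists_le_minimal hv
    exact ⟨u, by simpa using hu, huv⟩
  · rintro ⟨u, hu, huv⟩
    have hu : Minimal (· ∈ U) u := by simpa using hu
    exact hU huv hu.prop

/-- A multicoloured form of Khovanskii's theorem on the growth of sumsets. -/
theorem isEventuallyPolynomial_card_image {M : Type*} [AddCommMonoid M] [DecidableEq M]
    (hk : 0 < k) (φ : (Fin r → Fin k →₀ ℕ) →+ M) :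
    IsEventuallyPolynomial fun n : Fin r → ℕ => (((colouredVectors k n).image φ).card : ℝ) := by
  classical
  let θ : (Fin r → Fin k →₀ ℕ) → Lex (Fin r → Lex (Fin k →₀ ℕ)) :=
    fun v => toLex fun i => toLex (v i)
  have hθ : ∀ v w, θ (v + w) = θ v + θ w := fun _ _ => rfl
  have hθinj : Function.Injective θ := fun v w h => h
  let U : Set (Fin r → Fin k →₀ ℕ) :=
    {v | ∃ w, (∀ i, (w i).degree = (v i).degree) ∧ φ w = φ v ∧ θ w < θ v}
  have hU : IsUpperSet U := by
    rintro v v' hle ⟨w, hdeg, hφ, hlt⟩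
    obtain ⟨z, rfl⟩ := exists_add_of_le hle
    refine ⟨w + z, fun i => by simp [hdeg], by simp [hφ], ?_⟩
    rw [hθ, hθ]
    exact add_lt_add_left hlt _
  convert (isEventuallyPolynomial_card_colouredVectors hk).sub
    (isEventuallyPolynomial_card_filter_mem hk hU) using 2 with n
  rw [eq_sub_iff_add_eq]
  norm_cast
  rw [← Finset.card_filter_add_card_filter_not (s := colouredVectors k n) (fun v => v ∈ U),
    add_comm]
  congr 1
  have himage : (colouredVectors k n).image φ =
      ((colouredVectors k n).filter fun v => v ∉ U).image φ := by
    refine subset_antisymm ?_ (Finset.image_subset_image (Finset.filter_subset _ _))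
    intro x hx
    obtain ⟨v, hv, rfl⟩ := Finset.mem_image.1 hx
    obtain ⟨w, hw, hmin⟩ := Finset.exists_min_image
      ((colouredVectors k n).filter fun w => φ w = φ v) θ ⟨v, by simp [hv]⟩
    rw [Finset.mem_filter] at hw
    refine Finset.mem_image.2 ⟨w, Finset.mem_filter.2 ⟨hw.1, ?_⟩, hw.2⟩
    rintro ⟨z, hz, hφ, hlt⟩
    refine (hmin z ?_).not_gt hlt
    rw [Finset.mem_filter, mem_colouredVectors]
    exact ⟨fun i => (hz i).trans (mem_colouredVectors.1 hw.1 i), hφ.trans hw.2⟩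
  rw [himage, Finset.card_image_of_injOn]
  intro v hv w hw h
  rw [Finset.mem_coe, Finset.mem_filter, mem_colouredVectors] at hv hw
  by_contra hne
  rcases lt_or_gt_of_ne (hθinj.ne hne) with hlt | hlt
  · exact hw.2 ⟨v, fun i => (hv.1 i).trans (hw.1 i).symm, h, hlt⟩
  · exact hv.2 ⟨w, fun i => (hw.1 i).trans (hv.1 i).symm, h.symm, hlt⟩

end EventuallyPolynomial

section Noetherian

variable {𝕜 : Type*} [Field 𝕜] {d r k : ℕ}

theorem monomial_sum_mem_prod {ι : Type*} {s : Finset ι} {I : ι → Ideal (MvPolynomial (Fin d) 𝕜)}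
    {x : ι → Fin d →₀ ℕ} (h : ∀ i ∈ s, monomial (x i) (1 : 𝕜) ∈ I i) :
    monomial (∑ i ∈ s, x i) (1 : 𝕜) ∈ ∏ i ∈ s, I i := by
  rw [monomial_sum_one]
  exact Ideal.prod_mem_prod h

/-- The additive map sending an exponent vector in the letters `b i j` to the element it spells. -/
def evalLetters (b : Fin r → Fin k → Fin d →₀ ℕ) : (Fin r → Fin k →₀ ℕ) →+ (Fin d →₀ ℕ) where
  toFun v := ∑ i, ∑ j, v i j • b i j
  map_zero' := by simp
  map_add' v w := by simp [add_smul, Finset.sum_add_distrib]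

theorem evalLetters_apply (b : Fin r → Fin k → Fin d →₀ ℕ) (v : Fin r → Fin k →₀ ℕ) :
    evalLetters b v = ∑ i, ∑ j, v i j • b i j := rfl

/-- `K` is a monomial ideal containing `𝔪 ^ (c * |n|)` such that every monomial of `K` of degree at
most `c * |n|` is spelled by `n i` letters of each colour `i`. -/
structure IsSpelled (c : ℕ) (b : Fin r → Fin k → Fin d →₀ ℕ)
    (K : Ideal (MvPolynomial (Fin d) 𝕜)) (n : Fin r → ℕ) : Prop where
  isMonomial : IsMonomialIdeal K
  pow_le : mId 𝕜 d ^ (c * ∑ i, n i) ≤ K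
  exists_eq : ∀ x : Fin d →₀ ℕ, monomial x (1 : 𝕜) ∈ K → x.degree ≤ c * ∑ i, n i →
    ∃ v : Fin r → Fin k →₀ ℕ, (∀ i, (v i).degree = n i) ∧ evalLetters b v = x

variable {c : ℕ} {b : Fin r → Fin k → Fin d →₀ ℕ}

theorem IsSpelled.one : IsSpelled c b (1 : Ideal (MvPolynomial (Fin d) 𝕜)) 0 where
  isMonomial := Ideal.one_eq_top (R := MvPolynomial (Fin d) 𝕜) ▸ IsMonomialIdeal.top
  pow_le := by simp
  exists_eq x _ hx := by
    have hx0 : x = 0 := by simpa [Finsupp.degree_eq_zero_iff] using hx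
    exact ⟨0, by simp, by simp [hx0]⟩

theorem exists_add_degree_le {K L : Ideal (MvPolynomial (Fin d) 𝕜)} {p q : ℕ}
    (hKp : mId 𝕜 d ^ p ≤ K) {y z : Fin d →₀ ℕ} (hz : monomial z (1 : 𝕜) ∈ L)
    (hy : p ≤ y.degree) (hyz : (y + z).degree ≤ p + q) :
    ∃ y' z', monomial y' (1 : 𝕜) ∈ K ∧ monomial z' (1 : 𝕜) ∈ L ∧
      y'.degree ≤ p ∧ z'.degree ≤ q ∧ y' + z' = y + z := by
  obtain ⟨y', hle, hdeg⟩ := Finsupp.exists_le_degree_eq y p hy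
  obtain ⟨w, rfl⟩ := exists_add_of_le hle
  refine ⟨y', w + z, monomial_mem_of_mId_pow_le hKp hdeg.ge, monomial_mem_of_le le_add_self hz,
    hdeg.le, ?_, (add_assoc _ _ _).symm⟩
  simp only [map_add] at hyz ⊢
  omega

theorem IsSpelled.mul {K L : Ideal (MvPolynomial (Fin d) 𝕜)} {n m : Fin r → ℕ}
    (hK : IsSpelled c b K n) (hL : IsSpelled c b L m) : IsSpelled c b (K * L) (n + m) where
  isMonomial := hK.isMonomial.mul hL.isMonomial
  pow_le := by
    simp only [Pi.add_apply, Finset.sum_add_distrib, mul_add, pow_add]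
    exact Ideal.mul_mono hK.pow_le hL.pow_le
  exists_eq x hx hdeg := by
    simp only [Pi.add_apply, Finset.sum_add_distrib, mul_add] at hdeg
    obtain ⟨y, z, hy, hz, hyz⟩ : ∃ y z, monomial y (1 : 𝕜) ∈ K ∧ monomial z (1 : 𝕜) ∈ L ∧
        y.degree ≤ c * ∑ i, n i ∧ z.degree ≤ c * ∑ i, m i ∧ y + z = x := by
      obtain ⟨y, z, hy, hz, rfl⟩ := hK.isMonomial.exists_add_of_mem_mul hL.isMonomial hx
      rcases le_or_gt (c * ∑ i, n i) y.degree with h | h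
      · exact exists_add_degree_le hK.pow_le hz h hdeg
      rcases le_or_gt (c * ∑ i, m i) z.degree with h' | h'
      · obtain ⟨z', y', hz', hy', h1, h2, h3⟩ := exists_add_degree_le hL.pow_le hy h'
          (by rwa [add_comm z, add_comm (c * _)])
        exact ⟨y', z', hy', hz', h2, h1, by rw [add_comm, h3, add_comm]⟩
      · exact ⟨y, z, hy, hz, h.le, h'.le, rfl⟩
    obtain ⟨h1, h2, rfl⟩ := hyz
    obtain ⟨v, hv, rfl⟩ := hK.exists_eq y hy h1
    obtain ⟨w, hw, rfl⟩ := hL.exists_eq z hz h2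
    exact ⟨v + w, fun i => by simp [hv, hw], map_add _ _ _⟩

theorem IsSpelled.pow {K : Ideal (MvPolynomial (Fin d) 𝕜)} {n : Fin r → ℕ}
    (hK : IsSpelled c b K n) (t : ℕ) : IsSpelled c b (K ^ t) (t • n) := by
  induction t with
  | zero => simpa using IsSpelled.one
  | succ t ih =>
    rw [pow_succ, succ_nsmul]
    exact ih.mul hK

theorem IsSpelled.prod {I : Fin r → Ideal (MvPolynomial (Fin d) 𝕜)}
    (hI : ∀ i, IsSpelled c b (I i) (Pi.single i 1)) (n : Fin r → ℕ) :
    IsSpelled c b (∏ i, I i ^ n i) n := by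
  have h : ∀ s : Finset (Fin r),
      IsSpelled c b (∏ i ∈ s, I i ^ n i) (∑ i ∈ s, n i • Pi.single i 1) := by
    classical
    intro s
    induction s using Finset.induction_on with
    | empty => simpa using IsSpelled.one
    | insert i s hi ih =>
      rw [Finset.prod_insert hi, Finset.sum_insert hi]
      exact ((hI i).pow _).mul ih
  convert h Finset.univ
  ext j
  simp [Pi.single_apply]

theorem isSpelled_single {I : Ideal (MvPolynomial (Fin d) 𝕜)} (hI : IsMonomialIdeal I)
    (hc : mId 𝕜 d ^ c ≤ I) {i : Fin r}
    (hb : ∀ x : Fin d →₀ ℕ, monomial x (1 : 𝕜) ∈ I → x.degree ≤ c → ∃ j, b i j = x) :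
    IsSpelled c b I (Pi.single i 1) where
  isMonomial := hI
  pow_le := by simpa using hc
  exists_eq x hx hdeg := by
    obtain ⟨j, rfl⟩ := hb x hx (by simpa using hdeg)
    refine ⟨Pi.single i (Finsupp.single j 1), fun l => ?_, ?_⟩
    · rcases eq_or_ne l i with rfl | h
      · simp
      · simp [h]
    · rw [evalLetters_apply, Finset.sum_eq_single i, Finset.sum_eq_single j]
      · simp
      · intro l _ h
        simp [h.symm]
      · simp
      · intro l _ h
        simp [h]
      · simp

theorem exists_letters (hd : 0 < d) (c : ℕ) {I : Fin r → Ideal (MvPolynomial (Fin d) 𝕜)}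
    (hc : ∀ i, mId 𝕜 d ^ c ≤ I i) :
    ∃ k, 0 < k ∧ ∃ b : Fin r → Fin k → Fin d →₀ ℕ,
      (∀ i j, monomial (b i j) (1 : 𝕜) ∈ I i ∧ (b i j).degree ≤ c) ∧
      ∀ i x, monomial x (1 : 𝕜) ∈ I i → x.degree ≤ c → ∃ j, b i j = x := by
  classical
  have hfin := Finsupp.finite_of_degree_le (σ := Fin d) c
  let e := hfin.toFinset.equivFin
  let x₀ : Fin d →₀ ℕ := Finsupp.single ⟨0, hd⟩ c
  have hx₀ : x₀.degree = c := Finsupp.degree_single _ _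
  refine ⟨hfin.toFinset.card, Finset.card_pos.2 ⟨0, by simp⟩, fun i j =>
    if monomial (e.symm j : Fin d →₀ ℕ) (1 : 𝕜) ∈ I i then e.symm j else x₀, ?_, ?_⟩
  · intro i j
    have hj : (e.symm j : Fin d →₀ ℕ).degree ≤ c := by
      have := (e.symm j).2
      rwa [Set.Finite.mem_toFinset] at this
    dsimp only
    split_ifs with h
    · exact ⟨h, hj⟩
    · exact ⟨monomial_mem_of_mId_pow_le (hc i) hx₀.ge, hx₀.le⟩
  · intro i x hx hdeg
    refine ⟨e ⟨x, by simpa using hdeg⟩, ?_⟩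
    simp [hx]

theorem isEventuallyPolynomial_ncard_monomial_mem (hd : 0 < d)
    {I : Fin r → Ideal (MvPolynomial (Fin d) 𝕜)} (hI : ∀ i, IsMonomialIdeal (I i)) {c : ℕ}
    (hc : ∀ i, mId 𝕜 d ^ c ≤ I i) :
    IsEventuallyPolynomial fun n : Fin r → ℕ =>
      ({x : Fin d →₀ ℕ | monomial x (1 : 𝕜) ∈ ∏ i, I i ^ n i ∧
        x.degree ≤ c * ∑ i, n i}.ncard : ℝ) := by
  classical
  obtain ⟨k, hk, b, hb, hbs⟩ := exists_letters hd c hc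
  convert isEventuallyPolynomial_card_image hk (evalLetters b) using 3 with n
  rw [← Set.ncard_coe_finset]
  congr 1
  ext x
  rw [Finset.mem_coe, Finset.mem_image]
  simp only [mem_colouredVectors]
  constructor
  · rintro ⟨hx, hdeg⟩
    exact (IsSpelled.prod (fun i => isSpelled_single (hI i) (hc i) (hbs i)) n).exists_eq x hx hdeg
  · rintro ⟨v, hv, rfl⟩
    constructor
    · refine monomial_sum_mem_prod fun i _ => ?_
      rw [← hv i, Finsupp.degree_eq_sum, ← Finset.prod_pow_eq_pow_sum]
      exact monomial_sum_mem_prod fun j _ => monomial_nsmul_mem_pow (hb i j).1 _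
    · simp only [evalLetters_apply, map_sum, map_nsmul, Finset.mul_sum]
      refine Finset.sum_le_sum fun i _ => ?_
      rw [← hv i, Finsupp.degree_eq_sum, Finset.mul_sum]
      refine Finset.sum_le_sum fun j _ => ?_
      rw [smul_eq_mul, mul_comm]
      exact Nat.mul_le_mul_right _ (hb i j).2

theorem isEventuallyPolynomial_colength (hd : 0 < d)
    {I : Fin r → Ideal (MvPolynomial (Fin d) 𝕜)} (hI : ∀ i, IsMonomialIdeal (I i)) {c : ℕ}
    (hc : ∀ i, mId 𝕜 d ^ c ≤ I i) :
    IsEventuallyPolynomial fun n : Fin r → ℕ => (colength (∏ i, I i ^ n i) : ℝ) := by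
  convert (isEventuallyPolynomial_ncard_monomial_mem (𝕜 := 𝕜) (I := fun _ : Fin r => ⊤) (c := c) hd
    (fun _ => IsMonomialIdeal.top) (fun _ => le_top)).sub
    (isEventuallyPolynomial_ncard_monomial_mem hd hI hc) using 2 with n
  rw [eq_sub_iff_add_eq]
  norm_cast
  have hle : mId 𝕜 d ^ (c * ∑ i, n i) ≤ ∏ i, I i ^ n i := by
    rw [Finset.mul_sum, ← Finset.prod_pow_eq_pow_sum]
    exact Finset.prod_le_prod' fun i _ => pow_mul (mId 𝕜 d) c (n i) ▸ Ideal.pow_right_mono (hc i) _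
  have hdisj : Disjoint {x : Fin d →₀ ℕ | monomial x (1 : 𝕜) ∉ ∏ i, I i ^ n i}
      {x | monomial x (1 : 𝕜) ∈ ∏ i, I i ^ n i ∧ x.degree ≤ c * ∑ i, n i} :=
    Set.disjoint_left.2 fun x hx hx' => hx hx'.1
  rw [colength, ← Set.ncard_union_eq hdisj (finite_monomial_notMem hle)
    ((Finsupp.finite_of_degree_le _).subset fun x hx => hx.2)]
  congr 1
  ext x
  have htop : ∏ i, (⊤ : Ideal (MvPolynomial (Fin d) 𝕜)) ^ n i = ⊤ := by
    simp [← Ideal.one_eq_top]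
  simp only [Set.mem_union, Set.mem_ofPred_eq, htop, Submodule.mem_top, true_and]
  constructor
  · rintro (h | h)
    · exact le_of_not_ge fun h' => h (monomial_mem_of_mId_pow_le hle h')
    · exact h.2
  · intro h
    by_cases hx : monomial x (1 : 𝕜) ∈ ∏ i, I i ^ n i
    · exact Or.inr ⟨hx, h⟩
    · exact Or.inl hx

end Noetherian

section LeadingForm

theorem Polynomial.eq_coeff_of_tendsto_eval_div_pow {p : Polynomial ℝ} {d : ℕ} {L : ℝ}
    (h : Tendsto (fun k : ℕ => p.eval (k : ℝ) / (k : ℝ) ^ d) atTop (nhds L)) : L = p.coeff d := by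
  have hX : ((Polynomial.X : Polynomial ℝ) ^ d).degree = d := Polynomial.degree_X_pow d
  have hX0 : (Polynomial.X : Polynomial ℝ) ^ d ≠ 0 := pow_ne_zero _ Polynomial.X_ne_zero
  rcases lt_trichotomy p.degree (d : WithBot ℕ) with hlt | heq | hgt
  · have := (p.div_tendsto_atTop_zero_of_degree_lt (Polynomial.X ^ d) (hX ▸ hlt)).comp
      tendsto_natCast_atTop_atTop
    rw [Polynomial.coeff_eq_zero_of_degree_lt hlt]
    exact tendsto_nhds_unique h (by simpa [Function.comp_def] using this)
  · have := (p.div_tendsto_atTop_leadingCoeff_div_of_degree_eq (Polynomial.X ^ d)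
      (hX ▸ heq)).comp tendsto_natCast_atTop_atTop
    rw [← Polynomial.natDegree_eq_of_degree_eq_some heq]
    exact tendsto_nhds_unique h (by simpa [Function.comp_def] using this)
  · have := (p.abs_div_tendsto_atTop_atTop_of_degree_gt (Polynomial.X ^ d)
      (hX ▸ hgt) hX0).comp tendsto_natCast_atTop_atTop
    exact absurd (by simpa [Function.comp_def] using this)
      (not_tendsto_atTop_of_tendsto_nhds h.abs)

variable {r : ℕ}

theorem MvPolynomial.IsHomogeneous.eval_mul {P : MvPolynomial (Fin r) ℝ} {e : ℕ}
    (hP : P.IsHomogeneous e) (t : ℝ) (x : Fin r → ℝ) :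
    eval (fun i => t * x i) P = t ^ e * eval x P := by
  rw [eval_eq', eval_eq', Finset.mul_sum]
  refine Finset.sum_congr rfl fun y hy => ?_
  have hdeg : ∑ i, y i = e := by
    rw [← Finsupp.degree_eq_sum, Finsupp.degree_eq_weight_one]
    exact hP (mem_support_iff.1 hy)
  simp only [mul_pow, Finset.prod_mul_distrib, Finset.prod_pow_eq_pow_sum, hdeg]
  ring

theorem MvPolynomial.eq_eval_homogeneousComponent_of_tendsto {P : MvPolynomial (Fin r) ℝ} {d : ℕ}
    {x : Fin r → ℝ} {L : ℝ}
    (h : Tendsto (fun k : ℕ => eval (fun i => (k : ℝ) * x i) P / (k : ℝ) ^ d) atTop (nhds L)) :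
    L = eval x (homogeneousComponent d P) := by
  let p : Polynomial ℝ := ∑ e ∈ Finset.range (P.totalDegree + 1),
    Polynomial.C (eval x (homogeneousComponent e P)) * Polynomial.X ^ e
  have hp : ∀ t : ℝ, eval (fun i => t * x i) P = p.eval t := by
    intro t
    conv_lhs => rw [← sum_homogeneousComponent P, map_sum]
    simp only [p, Polynomial.eval_finsetSum, Polynomial.eval_mul, Polynomial.eval_C,
      Polynomial.eval_pow, Polynomial.eval_X]
    refine Finset.sum_congr rfl fun e _ => ?_
    rw [(homogeneousComponent_isHomogeneous e P).eval_mul, mul_comm]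
  simp only [hp] at h
  rw [Polynomial.eq_coeff_of_tendsto_eval_div_pow h]
  simp only [p, Polynomial.finsetSum_coeff, Polynomial.coeff_C_mul_X_pow, Finset.sum_ite_eq,
    Finset.mem_range]
  split_ifs with hd
  · rfl
  · rw [homogeneousComponent_eq_zero _ _ (by omega), map_zero]

theorem MvPolynomial.isClosed_setOf_eval_isHomogeneous (r d : ℕ) :
    IsClosed {f : (Fin r → ℕ) → ℝ | ∃ G : MvPolynomial (Fin r) ℝ, G.IsHomogeneous d ∧
      ∀ n, f n = eval (fun i => (n i : ℝ)) G} := by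
  let ev : MvPolynomial (Fin r) ℝ →ₗ[ℝ] ((Fin r → ℕ) → ℝ) :=
    LinearMap.pi fun n => (aeval fun i => (n i : ℝ)).toLinearMap
  have : Module.Finite ℝ (homogeneousSubmodule (Fin r) ℝ d) :=
    Module.Finite.iff_fg.2 (homogeneousSubmodule_fg (Fin r) ℝ d)
  convert ((homogeneousSubmodule (Fin r) ℝ d).map ev).closed_of_finiteDimensional
  ext f
  simp only [Set.mem_ofPred_eq, SetLike.mem_coe, Submodule.mem_map, mem_homogeneousSubmodule]
  refine exists_congr fun G => and_congr_right fun _ =>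
    ⟨fun h => _root_.funext fun n => (h n).symm, fun h n => (congrFun h n).symm⟩

variable {𝕜 : Type*} [Field 𝕜] {d : ℕ}

theorem exists_forall_mId_pow_le {I : Fin r → Ideal (MvPolynomial (Fin d) 𝕜)}
    (hc : ∀ i, ∃ c, mId 𝕜 d ^ c ≤ I i) : ∃ c, ∀ i, mId 𝕜 d ^ c ≤ I i := by
  choose c hc using hc
  exact ⟨∑ i, c i, fun i => (Ideal.pow_le_pow_right
    (Finset.single_le_sum (f := c) (fun _ _ => Nat.zero_le _) (Finset.mem_univ i))).trans (hc i)⟩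

theorem exists_mId_pow_le_prod {I : Fin r → Ideal (MvPolynomial (Fin d) 𝕜)}
    (hc : ∀ i, ∃ c, mId 𝕜 d ^ c ≤ I i) : ∃ c, mId 𝕜 d ^ c ≤ ∏ i, I i := by
  choose c hc using hc
  refine ⟨∑ i, c i, ?_⟩
  rw [← Finset.prod_pow_eq_pow_sum]
  exact Finset.prod_le_prod' fun i _ => hc i

theorem exists_mId_pow_le_pow {I : Ideal (MvPolynomial (Fin d) 𝕜)}
    (hc : ∃ c, mId 𝕜 d ^ c ≤ I) (k : ℕ) : ∃ c, mId 𝕜 d ^ c ≤ I ^ k := by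
  obtain ⟨c, hc⟩ := hc
  exact ⟨c * k, pow_mul (mId 𝕜 d) c k ▸ Ideal.pow_right_mono hc k⟩

/-- The mixed multiplicity polynomial of finitely many `𝔪`-primary monomial ideals. -/
theorem exists_isHomogeneous_tendsto_colength_prod_pow (hd : 0 < d)
    {I : Fin r → Ideal (MvPolynomial (Fin d) 𝕜)} (hI : ∀ i, IsMonomialIdeal (I i))
    (hc : ∀ i, ∃ c, mId 𝕜 d ^ c ≤ I i) :
    ∃ G : MvPolynomial (Fin r) ℝ, G.IsHomogeneous d ∧ ∀ n : Fin r → ℕ,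
      Tendsto (fun k : ℕ => (colength ((∏ i, I i ^ n i) ^ k) : ℝ) / (k : ℝ) ^ d) atTop
        (nhds (eval (fun i => (n i : ℝ)) G)) ∧
      eval (fun i => (n i : ℝ)) G ≤ colength (∏ i, I i ^ n i) := by
  obtain ⟨c, hc'⟩ := exists_forall_mId_pow_le hc
  obtain ⟨P, N, hP⟩ := isEventuallyPolynomial_colength hd hI hc'
  let Q : MvPolynomial (Fin r) ℝ := bind₁ (fun i => X i + C (N : ℝ)) P
  refine ⟨homogeneousComponent d Q, homogeneousComponent_isHomogeneous d Q, fun n => ?_⟩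
  obtain ⟨p, hp⟩ := exists_mId_pow_le_prod fun i => exists_mId_pow_le_pow (hc i) (n i)
  obtain ⟨q, hq⟩ := exists_mId_pow_le_prod fun i => exists_mId_pow_le_pow (hc i) N
  obtain ⟨L, hL, hLle⟩ := exists_tendsto_colength hd
    (isGradedFamily_pow (∏ i, I i ^ n i)) fun k => exists_mId_pow_le_pow ⟨p, hp⟩ k
  obtain ⟨D, hD⟩ := exists_colength_pow_mul_le hd hp hq
  have hQ : ∀ k : ℕ, eval (fun i => (k : ℝ) * (n i : ℝ)) Q =
      (colength ((∏ i, I i ^ n i) ^ k * ∏ i, I i ^ N) : ℝ) := by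
    intro k
    have h := hP (fun i => k * n i + N) fun i => Nat.le_add_left _ _
    simp only [pow_add, Finset.prod_mul_distrib, mul_comm k, pow_mul, Finset.prod_pow] at h ⊢
    rw [h, eval_bind₁_eq]
    congr 2
    ext i
    simp [mul_comm]
  have hlim : Tendsto (fun k : ℕ => eval (fun i => (k : ℝ) * (n i : ℝ)) Q / (k : ℝ) ^ d) atTop
      (nhds L) := by
    have hup : Tendsto (fun k : ℕ => (colength ((∏ i, I i ^ n i) ^ k) : ℝ) / (k : ℝ) ^ d +
        (D : ℝ) / k) atTop (nhds (L + 0)) := hL.add (tendsto_const_div_atTop_nhds_zero_nat _)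
    rw [add_zero] at hup
    refine tendsto_of_tendsto_of_tendsto_of_le_of_le' hL hup ?_ ?_
    · refine Eventually.of_forall fun k => ?_
      simp only [hQ]
      gcongr
      refine colength_anti Ideal.mul_le_left (c := p * k + q) ?_
      rw [pow_add, pow_mul]
      exact Ideal.mul_mono (Ideal.pow_right_mono hp k) hq
    · filter_upwards [eventually_gt_atTop 0] with k hk
      have h : (colength ((∏ i, I i ^ n i) ^ k * ∏ i, I i ^ N) : ℝ) ≤
          colength ((∏ i, I i ^ n i) ^ k) + D * (k : ℝ) ^ (d - 1) := by
        exact_mod_cast hD k k le_rfl hk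
      have hk' : (0 : ℝ) < k := by exact_mod_cast hk
      have hkd : (k : ℝ) ^ d = k ^ (d - 1) * k := by rw [← pow_succ, Nat.sub_add_cancel hd]
      rw [hQ]
      calc _ ≤ (colength ((∏ i, I i ^ n i) ^ k) + D * (k : ℝ) ^ (d - 1)) / (k : ℝ) ^ d := by gcongr
        _ = _ := by
          rw [add_div]
          congr 1
          rw [hkd]
          field_simp
  rw [← MvPolynomial.eq_eval_homogeneousComponent_of_tendsto hlim]
  exact ⟨hL, by simpa using hLle 1 one_pos⟩

end LeadingForm

/-- **Existence of mixed multiplicities, `𝔪`-primary case.**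
For graded families `𝕁(1), …, 𝕁(r)` of `𝔪`-primary monomial ideals, the limit
`F(𝐧) = lim_m dim_𝕜(R / J(1)_{m n₁} ⋯ J(r)_{m n_r}) / m^d` exists for every `𝐧 ∈ ℕ^r`
and agrees with a homogeneous polynomial `G` of total degree `d` with real coefficients. -/
theorem statement1 {𝕜 : Type*} [Field 𝕜] (d r : ℕ) (hd : 0 < d)
    (J : Fin r → ℕ → Ideal (MvPolynomial (Fin d) 𝕜))
    (hJ : ∀ i, IsGradedFamily (J i))
    (hJmon : ∀ i n, IsMonomialIdeal (J i n))
    (hJprim : ∀ i n, 0 < n → IsMPrimary (J i n)) :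
    ∃ G : MvPolynomial (Fin r) ℝ,
      G.IsHomogeneous d ∧
      ∀ n : Fin r → ℕ,
        Tendsto
          (fun m : ℕ =>
            (Module.finrank 𝕜 (MvPolynomial (Fin d) 𝕜 ⧸ (∏ i, J i (m * n i))) : ℝ) /
              (m : ℝ) ^ d)
          atTop
          (nhds (MvPolynomial.eval (fun i => (n i : ℝ)) G)) := by
  classical
  have hcof : ∀ i n, ∃ c, mId 𝕜 d ^ c ≤ J i n := by
    intro i n
    rcases Nat.eq_zero_or_pos n with rfl | hn
    · exact ⟨0, by simp [(hJ i).1]⟩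
    · exact (hJprim i n hn).2
  have hprod : ∀ (n : Fin r → ℕ) (m : ℕ), ∃ c, mId 𝕜 d ^ c ≤ ∏ i, J i (m * n i) := fun n m =>
    exists_mId_pow_le_prod fun i => hcof i _
  choose F hF hFle using fun n : Fin r → ℕ =>
    exists_tendsto_colength hd (IsGradedFamily.prod (s := Finset.univ) hJ n) (hprod n)
  choose G hGhom hG hGle using fun a : ℕ =>
    exists_isHomogeneous_tendsto_colength_prod_pow hd (fun i => hJmon i a) fun i => hcof i a
  have hlower : ∀ (a : ℕ), 0 < a → ∀ n : Fin r → ℕ,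
      F n ≤ eval (fun i => (n i : ℝ)) (G a) / (a : ℝ) ^ d := by
    intro a ha n
    have ha' : (0 : ℝ) < a := by exact_mod_cast ha
    rw [le_div_iff₀ (by positivity)]
    refine ge_of_tendsto (hG a n) ?_
    filter_upwards [eventually_gt_atTop 0] with k hk
    have hk' : (0 : ℝ) < k := by exact_mod_cast hk
    have h1 := hFle n (a * k) (Nat.mul_pos ha hk)
    have h2 : (∏ i, J i a ^ n i) ^ k ≤ ∏ i, J i (a * k * n i) := by
      rw [← Finset.prod_pow]
      refine Finset.prod_le_prod' fun i _ => ?_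
      rw [← pow_mul, mul_assoc, mul_comm k]
      exact (hJ i).pow_le _ _
    obtain ⟨c, hc⟩ := exists_mId_pow_le_pow
      (exists_mId_pow_le_prod fun i => exists_mId_pow_le_pow (hcof i a) (n i)) k
    have h3 : (colength (∏ i, J i (a * k * n i)) : ℝ) ≤ colength ((∏ i, J i a ^ n i) ^ k) := by
      exact_mod_cast colength_anti h2 hc
    rw [le_div_iff₀ (by positivity)] at h1 ⊢
    push_cast at h1
    rw [mul_pow, ← mul_assoc] at h1
    exact h1.trans h3
  have hupper : ∀ (n : Fin r → ℕ) (m N : ℕ), 0 < m → 0 < N → (∀ i, n i ≠ 0 → n i ∣ N) →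
      eval (fun i => (n i : ℝ)) (G (m * N)) / ((m * N : ℕ) : ℝ) ^ d ≤
        (colength (∏ i, J i (m * n i)) : ℝ) / (m : ℝ) ^ d := by
    intro n m N hm hN hdvd
    have hm' : (0 : ℝ) < m := by exact_mod_cast hm
    have hN' : (0 : ℝ) < N := by exact_mod_cast hN
    have h1 : (∏ i, J i (m * n i)) ^ N ≤ ∏ i, J i (m * N) ^ n i := by
      rw [← Finset.prod_pow]
      refine Finset.prod_le_prod' fun i _ => ?_
      rcases eq_or_ne (n i) 0 with h0 | h0
      · simp [h0]
      · obtain ⟨t, ht⟩ := hdvd i h0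
        have := Ideal.pow_right_mono ((hJ i).pow_le (m * n i) t) (n i)
        rwa [← pow_mul, mul_assoc, ← ht, mul_comm t, ← ht] at this
    obtain ⟨c, hc⟩ := hprod n m
    have h2 : colength (∏ i, J i (m * N) ^ n i) ≤ N ^ d * colength (∏ i, J i (m * n i)) :=
      (colength_anti h1 (c := c * N) (pow_mul (mId 𝕜 d) c N ▸ Ideal.pow_right_mono hc N)).trans
        (colength_pow_le hc N)
    have h3 : (colength (∏ i, J i (m * N) ^ n i) : ℝ) ≤
        (N : ℝ) ^ d * colength (∏ i, J i (m * n i)) := by exact_mod_cast h2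
    rw [div_le_div_iff₀ (by positivity) (by positivity)]
    push_cast
    calc _ ≤ (N : ℝ) ^ d * colength (∏ i, J i (m * n i)) * (m : ℝ) ^ d := by
          gcongr
          exact (hGle (m * N) n).trans h3
      _ = _ := by ring
  have hlim : Tendsto (fun (t : ℕ) (n : Fin r → ℕ) =>
      eval (fun i => (n i : ℝ)) (G t.factorial) / (t.factorial : ℝ) ^ d) atTop (nhds F) := by
    refine tendsto_pi_nhds.2 fun n => tendsto_order.2 ⟨fun b hb => ?_, fun b hb => ?_⟩
    · exact Eventually.of_forall fun t => hb.trans_le (hlower _ t.factorial_pos n)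
    · obtain ⟨m, hmb, hm⟩ := (((hF n).eventually_lt_const hb).and (eventually_gt_atTop 0)).exists
      have hD : 0 < ∏ i, max 1 (n i) := Finset.prod_pos fun i _ => by positivity
      filter_upwards [eventually_ge_atTop (m * ∏ i, max 1 (n i))] with t ht
      obtain ⟨s, hs⟩ := Nat.dvd_factorial (Nat.mul_pos hm hD) ht
      rw [mul_assoc] at hs
      have hspos : 0 < (∏ i, max 1 (n i)) * s :=
        Nat.pos_of_ne_zero fun h => t.factorial_ne_zero (by rw [hs, h, mul_zero])
      rw [hs]
      refine (hupper n m _ hm hspos fun i hi => ?_).trans_lt hmb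
      have h1 : max 1 (n i) = n i := max_eq_right (Nat.one_le_iff_ne_zero.2 hi)
      have h2 : max 1 (n i) ∣ ∏ i, max 1 (n i) := Finset.dvd_prod_of_mem _ (Finset.mem_univ i)
      rw [h1] at h2
      exact h2.mul_right s
  obtain ⟨G₀, hG₀, hFG⟩ := (MvPolynomial.isClosed_setOf_eval_isHomogeneous r d).mem_of_tendsto hlim
    (Eventually.of_forall fun t => ⟨C ((t.factorial : ℝ) ^ d)⁻¹ * G t.factorial,
      (hGhom _).C_mul _, fun n => by simp only [map_mul, eval_C, div_eq_inv_mul]⟩)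
  refine ⟨G₀, hG₀, fun n => ?_⟩
  rw [← hFG n]
  refine (hF n).congr fun m => ?_
  obtain ⟨c, hc⟩ := hprod n m
  rw [finrank_quotient_eq_colength (IsMonomialIdeal.prod fun i => hJmon i _) hc]
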